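/- arXiv:2509.21442 — 7 statements merged into one kernel-verified Lean document; each statement's English description precedes it below -/
import Mathlib

section
/- Let B_L, B_R ∈ ℝ^{N×N} be symmetric matrices satisfying the boundary exactness conditions 𝐟ᵀ B_L 𝐠 = f(ω_M)g(ω_M) − f(ω_L)g(ω_L) and 𝐟ᵀ B_R 𝐠 = f(ω_R)g(ω_R) − f(ω_M)g(ω_M) for all f, g ∈ 𝔉. Let P_L, P_R be diagonal matrices with positive entries exactly at indices n ≤ N_L (for P_L) and n > N_L (for P_R) and zero otherwise, let S_L, S_R be skew-symmetric, and set Q_{L/R} = S_{L/R} + B_{L/R}/2, B = B_L + B_R, P = P_L + P_R, Q = Q_L + Q_R, D = P^{-1}Q. Let V = [𝐟_1, …, 𝐟_K] ∈ ℝ^{N×K} and V' = [𝐟'_1, …, 𝐟'_K] ∈ ℝ^{N×K} be the Vandermonde matrices of nodal values of the basis functions and their derivatives. Then D = P^{-1}Q is an 𝔉-exact sub-cell SBP operator for (Ω_ref, Ω_L, Ω_R) if and only if both matrix equations hold: S_L V + S_R V − P_L V' − P_R V' + B V / 2 = 0 and P_L S_R − P_R S_L + P_L B_R / 2 − P_R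 B_L / 2 = 0. -/
open Matrix

/-- `f` lies in the span of the basis functions `fs`. -/
def InSpan {K : ℕ} (fs : Fin K → ℝ → ℝ) (f : ℝ → ℝ) : Prop :=
  ∃ c : Fin K → ℝ, f = fun t => ∑ k, c k * fs k t

/-- An `𝔉`-exact sub-cell SBP operator for `(Ω_ref, Ω_L, Ω_R)` on the nodes `x`,
with `Ω_ref = [ωL, ωR]`, `Ω_L = [ωL, ωM]`, `Ω_R = [ωM, ωR]`, where `𝔉 = span fs`. -/
def IsSubcellSBP {NL NR K : ℕ} (fs : Fin K → ℝ → ℝ)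
    (x : Fin NL ⊕ Fin NR → ℝ) (ωL ωM ωR : ℝ)
    (D PL PR QL QR BL BR : Matrix (Fin NL ⊕ Fin NR) (Fin NL ⊕ Fin NR) ℝ) : Prop :=
  -- `D = P⁻¹ Q`
  D = (PL + PR)⁻¹ * (QL + QR) ∧
  -- (i) exactness of the derivative
  (∀ f : ℝ → ℝ, InSpan fs f →
    D.mulVec (fun i => f (x i)) = fun i => deriv f (x i)) ∧
  -- (ii) `P_L`, `P_R` diagonal, positive exactly on the left/right nodes
  (∀ i j, i ≠ j → PL i j = 0) ∧
  (∀ i : Fin NL, 0 < PL (Sum.inl i) (Sum.inl i)) ∧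
  (∀ i : Fin NR, PL (Sum.inr i) (Sum.inr i) = 0) ∧
  (∀ i j, i ≠ j → PR i j = 0) ∧
  (∀ i : Fin NR, 0 < PR (Sum.inr i) (Sum.inr i)) ∧
  (∀ i : Fin NL, PR (Sum.inl i) (Sum.inl i) = 0) ∧
  -- (iii) sub-cell SBP relations
  PL * D = QL ∧ PR * D = QR ∧ QL + QLᵀ = BL ∧ QR + QRᵀ = BR ∧
  -- (iv) boundary exactness
  (∀ f g : ℝ → ℝ, InSpan fs f → InSpan fs g →
    (fun i => f (x i)) ⬝ᵥ BL.mulVec (fun i => g (x i)) = f ωM * g ωM - f ωL * g ωL) ∧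
  (∀ f g : ℝ → ℝ, InSpan fs f → InSpan fs g →
    (fun i => f (x i)) ⬝ᵥ BR.mulVec (fun i => g (x i)) = f ωR * g ωR - f ωM * g ωM)

/-- An `𝔉`-exact SBP operator on a single cell `[ωa, ωb]` with nodes `xs`. -/
def IsSBP {n K : ℕ} (fs : Fin K → ℝ → ℝ) (xs : Fin n → ℝ) (ωa ωb : ℝ)
    (Dm Pm Bm : Matrix (Fin n) (Fin n) ℝ) : Prop :=
  (∀ f : ℝ → ℝ, InSpan fs f →
    Dm.mulVec (fun i => f (xs i)) = fun i => deriv f (xs i)) ∧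
  (∀ i j, i ≠ j → Pm i j = 0) ∧
  (∀ i, 0 < Pm i i) ∧
  Pm * Dm + (Pm * Dm)ᵀ = Bm ∧
  (∀ f g : ℝ → ℝ, InSpan fs f → InSpan fs g →
    (fun i => f (xs i)) ⬝ᵥ Bm.mulVec (fun i => g (xs i)) = f ωb * g ωb - f ωa * g ωa)

/-- A matrix differentiates every function in `span fs` at the nodes iff it maps the Vandermonde
matrix of `fs` to that of the derivatives. -/
theorem forall_inSpan_mulVec_eq_deriv_iff {ι : Type*} [Fintype ι] {K : ℕ} {fs : Fin K → ℝ → ℝ}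
    (hdiff : ∀ k, Differentiable ℝ (fs k)) (x : ι → ℝ) (D : Matrix ι ι ℝ) :
    (∀ f : ℝ → ℝ, InSpan fs f → D.mulVec (fun i => f (x i)) = fun i => deriv f (x i)) ↔
      D * Matrix.of (fun i k => fs k (x i)) =
        Matrix.of (fun i (k : Fin K) => deriv (fs k) (x i)) := by
  constructor
  · intro h
    ext i k
    have hk : InSpan fs (fs k) := ⟨Pi.single k 1, by ext t; simp [Pi.single_apply]⟩
    exact congrFun (h _ hk) i
  · rintro h f ⟨c, rfl⟩
    have hval : (fun i => ∑ k, c k * fs k (x i)) =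
        (Matrix.of (fun i k => fs k (x i))).mulVec c := by
      ext i
      simp [Matrix.mulVec, dotProduct, mul_comm]
    rw [hval, Matrix.mulVec_mulVec, h]
    ext i
    rw [deriv_fun_sum fun k _ => ((hdiff k) (x i)).const_mul (c k)]
    simp [Matrix.mulVec, dotProduct, mul_comm]

/-- For diagonal `A`, `B` with complementary supports, the relation `(A + B) D = M + N` splits into
`A D = M` and `B D = N` iff `A N = B M`. -/
theorem diagonal_mul_eq_and_iff {ι R : Type*} [Fintype ι] [DecidableEq ι] [CommRing R]
    [IsDomain R] {a b : ι → R} (hab : ∀ i, (a i ≠ 0 ∧ b i = 0) ∨ (a i = 0 ∧ b i ≠ 0))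
    {D M N : Matrix ι ι R} (h : (diagonal a + diagonal b) * D = M + N) :
    (diagonal a * D = M ∧ diagonal b * D = N) ↔ diagonal a * N = diagonal b * M := by
  simp only [← Matrix.ext_iff, ← forall_and, add_mul, Matrix.add_apply,
    diagonal_mul] at h ⊢
  refine forall₂_congr fun i j => ?_
  have hij := h i j
  rcases hab i with ⟨ha, hb⟩ | ⟨ha, hb⟩
  · simp only [hb, zero_mul, add_zero, mul_eq_zero, ha, false_or] at hij ⊢
    exact ⟨fun hh => hh.2.symm, fun hh => ⟨by rw [hij, hh, add_zero], hh.symm⟩⟩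
  · simp only [ha, zero_mul, zero_add, zero_eq_mul, hb, false_or] at hij ⊢
    exact ⟨fun hh => hh.1.symm, fun hh => ⟨hh.symm, by rw [hij, hh, zero_add]⟩⟩

/-- Under the structural assumptions on `B_{L/R}`, `P_{L/R}`, `S_{L/R}`,
the operator `D = P⁻¹ Q` is an `𝔉`-exact sub-cell SBP operator iff the two matrix
equations (exactness and splitting compatibility) hold. -/
theorem subcell_sbp_iff_matrix_equations {NL NR K : ℕ} (fs : Fin K → ℝ → ℝ)
    (hdiff : ∀ k, Differentiable ℝ (fs k))
    (ωL ωM ωR : ℝ) (hLM : ωL < ωM) (hMR : ωM < ωR)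
    (x : Fin NL ⊕ Fin NR → ℝ)
    (hxL : ∀ i, x (Sum.inl i) ∈ Set.Icc ωL ωM)
    (hxR : ∀ i, x (Sum.inr i) ∈ Set.Icc ωM ωR)
    (BL BR PL PR SL SR D : Matrix (Fin NL ⊕ Fin NR) (Fin NL ⊕ Fin NR) ℝ)
    (hBLsym : BLᵀ = BL) (hBRsym : BRᵀ = BR)
    (hBLex : ∀ f g : ℝ → ℝ, InSpan fs f → InSpan fs g →
      (fun i => f (x i)) ⬝ᵥ BL.mulVec (fun i => g (x i)) = f ωM * g ωM - f ωL * g ωL)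
    (hBRex : ∀ f g : ℝ → ℝ, InSpan fs f → InSpan fs g →
      (fun i => f (x i)) ⬝ᵥ BR.mulVec (fun i => g (x i)) = f ωR * g ωR - f ωM * g ωM)
    (hPLdiag : ∀ i j, i ≠ j → PL i j = 0)
    (hPLpos : ∀ i : Fin NL, 0 < PL (Sum.inl i) (Sum.inl i))
    (hPLzero : ∀ i : Fin NR, PL (Sum.inr i) (Sum.inr i) = 0)
    (hPRdiag : ∀ i j, i ≠ j → PR i j = 0)
    (hPRpos : ∀ i : Fin NR, 0 < PR (Sum.inr i) (Sum.inr i))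
    (hPRzero : ∀ i : Fin NL, PR (Sum.inl i) (Sum.inl i) = 0)
    (hSLskew : SLᵀ = -SL) (hSRskew : SRᵀ = -SR)
    (hD : D = (PL + PR)⁻¹ * ((SL + (1 / 2 : ℝ) • BL) + (SR + (1 / 2 : ℝ) • BR))) :
    IsSubcellSBP fs x ωL ωM ωR D PL PR
      (SL + (1 / 2 : ℝ) • BL) (SR + (1 / 2 : ℝ) • BR) BL BR ↔
    (SL * Matrix.of (fun i k => fs k (x i)) + SR * Matrix.of (fun i k => fs k (x i))
        - PL * Matrix.of (fun i (k : Fin K) => deriv (fs k) (x i))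
        - PR * Matrix.of (fun i (k : Fin K) => deriv (fs k) (x i))
        + (1 / 2 : ℝ) • ((BL + BR) * Matrix.of (fun i k => fs k (x i))) = 0 ∧
      PL * SR - PR * SL + (1 / 2 : ℝ) • (PL * BR) - (1 / 2 : ℝ) • (PR * BL) = 0) := by
  obtain ⟨a, rfl⟩ : ∃ a, PL = diagonal a :=
    ⟨fun i => PL i i, by ext i j; by_cases hij : i = j <;> simp [hij, hPLdiag i j]⟩
  obtain ⟨b, rfl⟩ : ∃ b, PR = diagonal b :=
    ⟨fun i => PR i i, by ext i j; by_cases hij : i = j <;> simp [hij, hPRdiag i j]⟩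
  have hab : ∀ i, (a i ≠ 0 ∧ b i = 0) ∨ (a i = 0 ∧ b i ≠ 0) := by
    simp only [diagonal_apply_eq] at hPLpos hPLzero hPRpos hPRzero
    rintro (i | i)
    · exact .inl ⟨(hPLpos i).ne', hPRzero i⟩
    · exact .inr ⟨hPLzero i, (hPRpos i).ne'⟩
  have hP : IsUnit (diagonal a + diagonal b).det := by
    rw [diagonal_add, det_diagonal, isUnit_iff_ne_zero, Finset.prod_ne_zero_iff]
    intro i _
    rcases hab i with ⟨ha, hb⟩ | ⟨ha, hb⟩ <;> simp [ha, hb]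
  have hPD : (diagonal a + diagonal b) * D =
      (SL + (1 / 2 : ℝ) • BL) + (SR + (1 / 2 : ℝ) • BR) := by
    rw [hD, mul_nonsing_inv_cancel_left _ _ hP]
  have hsym : ∀ S B : Matrix (Fin NL ⊕ Fin NR) (Fin NL ⊕ Fin NR) ℝ, Sᵀ = -S → Bᵀ = B →
      (S + (1 / 2 : ℝ) • B) + (S + (1 / 2 : ℝ) • B)ᵀ = B := by
    intro S B hS hB
    rw [transpose_add, transpose_smul, hS, hB]
    module
  have hexact := forall_inSpan_mulVec_eq_deriv_iff hdiff x D
  have hsplit := diagonal_mul_eq_and_iff hab hPD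
  set V : Matrix (Fin NL ⊕ Fin NR) (Fin K) ℝ := Matrix.of fun i k => fs k (x i)
  set V' : Matrix (Fin NL ⊕ Fin NR) (Fin K) ℝ := Matrix.of fun i k => deriv (fs k) (x i)
  have hfirst : SL * V + SR * V - diagonal a * V' - diagonal b * V'
      + (1 / 2 : ℝ) • ((BL + BR) * V) = 0 ↔ D * V = V' := by
    have hdiff_eq : SL * V + SR * V - diagonal a * V' - diagonal b * V'
        + (1 / 2 : ℝ) • ((BL + BR) * V) = (diagonal a + diagonal b) * (D * V - V') := by
      rw [Matrix.mul_sub, ← Matrix.mul_assoc, hPD]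
      simp only [Matrix.add_mul, Matrix.smul_mul]
      module
    rw [hdiff_eq, ← sub_eq_zero (a := D * V)]
    refine ⟨fun h => ?_, fun h => by rw [h, Matrix.mul_zero]⟩
    rw [← nonsing_inv_mul_cancel_left _ (D * V - V') hP, h, Matrix.mul_zero]
  have hsecond : diagonal a * SR - diagonal b * SL + (1 / 2 : ℝ) • (diagonal a * BR)
      - (1 / 2 : ℝ) • (diagonal b * BL) = 0 ↔
      diagonal a * (SR + (1 / 2 : ℝ) • BR) = diagonal b * (SL + (1 / 2 : ℝ) • BL) := by
    rw [← sub_eq_zero (a := diagonal a * (SR + (1 / 2 : ℝ) • BR))]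
    simp only [mul_add, Matrix.mul_smul]
    rw [show ∀ p q r s : Matrix (Fin NL ⊕ Fin NR) (Fin NL ⊕ Fin NR) ℝ,
      p - q + r - s = p + r - (q + s) from fun _ _ _ _ => by abel]
  rw [hfirst, hsecond, ← hexact, ← hsplit]
  constructor
  · rintro ⟨-, hder, -, -, -, -, -, -, hL, hR, -⟩
    exact ⟨hder, hL, hR⟩
  · rintro ⟨hder, hL, hR⟩
    exact ⟨hD, hder, hPLdiag, hPLpos, hPLzero, hPRdiag, hPRpos, hPRzero, hL, hR,
      hsym SL BL hSLskew hBLsym, hsym SR BR hSRskew hBRsym, hBLex, hBRex⟩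
end

section
/- Under the overset semi-discretization setup, for every t > 0 the discrete overset energy E(u, v)(t) = u(t)ᵀ P_u u(t) + v(t)ᵀ P_v v(t) − u(t)ᵀ P_{O_u} u(t) (which equals u(t)ᵀ P_ū u(t) + v(t)ᵀ P_v v(t)) satisfies the energy identity d/dt E(u, v)(t) = −α ( v_d(t)² − g(t)² ) − α ( g(t) − u_a(t) )² − α ( u_{b_L}(t) − v_b(t) )², and in particular d/dt E(u, v)(t) ≤ α g(t)². -/
open Matrix

/-- The derivative of a symmetric quadratic form along a differentiable curve. -/
theorem hasDerivAt_dotProduct_mulVec_self {ι : Type*} [Fintype ι] {P : Matrix ι ι ℝ}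
    (hP : P.IsSymm) {w : ℝ → ι → ℝ} {w' : ι → ℝ} {t : ℝ} (hw : HasDerivAt w w' t) :
    HasDerivAt (fun s => w s ⬝ᵥ P *ᵥ w s) (2 * (w t ⬝ᵥ P *ᵥ w')) t := by
  have hi := hasDerivAt_pi.1 hw
  have hPw (i : ι) : HasDerivAt (fun s => (P *ᵥ w s) i) ((P *ᵥ w') i) t := by
    simp only [mulVec, dotProduct]
    exact HasDerivAt.fun_sum fun j _ => (hi j).const_mul (P i j)
  have hsum : HasDerivAt (fun s => w s ⬝ᵥ P *ᵥ w s) (w' ⬝ᵥ P *ᵥ w t + w t ⬝ᵥ P *ᵥ w') t := by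
    simp only [dotProduct, ← Finset.sum_add_distrib]
    exact HasDerivAt.fun_sum fun i _ => (hi i).mul (hPw i)
  convert hsum using 1
  have hsymm : w' ⬝ᵥ P *ᵥ w t = w t ⬝ᵥ P *ᵥ w' := by
    rw [dotProduct_mulVec, ← mulVec_transpose, hP.eq, dotProduct_comm]
  rw [hsymm, two_mul]

/-- Summation by parts for a quadratic form. -/
theorem two_mul_dotProduct_mulVec_of_sbp {ι : Type*} [Fintype ι] {P D : Matrix ι ι ℝ}
    {a b : ι → ℝ} (h : P * D + (P * D)ᵀ = vecMulVec a a - vecMulVec b b) (w : ι → ℝ) :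
    2 * (w ⬝ᵥ P *ᵥ (D *ᵥ w)) = (a ⬝ᵥ w) ^ 2 - (b ⬝ᵥ w) ^ 2 := by
  have hw := congrArg (fun M => w ⬝ᵥ M *ᵥ w) h
  simp only [add_mulVec, sub_mulVec, dotProduct_add, dotProduct_sub, vecMulVec_mulVec,
    mulVec_transpose, op_smul_eq_smul, dotProduct_smul, smul_eq_mul] at hw
  rw [dotProduct_comm w (w ᵥ* (P * D)), ← dotProduct_mulVec, ← mulVec_mulVec,
    dotProduct_comm w a, dotProduct_comm w b] at hw
  linarith

/-- A diagonal matrix with nonzero diagonal entries cancels its inverse. -/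
theorem Matrix.IsDiag.mulVec_inv_mulVec {ι : Type*} [Fintype ι] [DecidableEq ι]
    {P : Matrix ι ι ℝ} (hP : P.IsDiag) (h0 : ∀ i, P i i ≠ 0) (x : ι → ℝ) :
    P *ᵥ (P⁻¹ *ᵥ x) = x := by
  have hdet : IsUnit P.det := by
    rw [← hP.diagonal_diag, det_diagonal]
    exact isUnit_iff_ne_zero.2 (Finset.prod_ne_zero_iff.2 fun i _ => h0 i)
  rw [mulVec_mulVec, mul_nonsing_inv P hdet, one_mulVec]

theorem Matrix.IsDiag.mulVec_apply {ι : Type*} [Fintype ι] [DecidableEq ι]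
    {P : Matrix ι ι ℝ} (hP : P.IsDiag) (x : ι → ℝ) (i : ι) : (P *ᵥ x) i = P i i * x i := by
  conv_lhs => rw [← hP.diagonal_diag, mulVec_diagonal, diag_apply]


open Matrix

/-- Discrete energy stability for the sub-cell SBP overset
semi-discretization: the discrete overset energy satisfies the dissipative identity and is
bounded by the boundary data. -/
theorem discrete_overset_energy_stability (m n Nv : ℕ)
    (hm : 0 < m) (hn : 0 < n) (hNv : 0 < Nv)
    (α : ℝ) (hα : 0 < α) (g : ℝ → ℝ)
    -- sub-cell SBP operator on the left mesh
    (Du Pub POu : Matrix (Fin (m + n)) (Fin (m + n)) ℝ)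
    (hPub_offdiag : ∀ i j, i ≠ j → Pub i j = 0)
    (hPub_pos : ∀ i : Fin (m + n), (i : ℕ) < m → 0 < Pub i i)
    (hPub_zero : ∀ i : Fin (m + n), m ≤ (i : ℕ) → Pub i i = 0)
    (hPOu_offdiag : ∀ i j, i ≠ j → POu i j = 0)
    (hPOu_pos : ∀ i : Fin (m + n), m ≤ (i : ℕ) → 0 < POu i i)
    (hPOu_zero : ∀ i : Fin (m + n), (i : ℕ) < m → POu i i = 0)
    (eA eBL eBR eC : Fin (m + n) → ℝ)
    (heA_supp : ∀ i : Fin (m + n), m ≤ (i : ℕ) → eA i = 0)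
    (heBL_supp : ∀ i : Fin (m + n), m ≤ (i : ℕ) → eBL i = 0)
    (heBR_supp : ∀ i : Fin (m + n), (i : ℕ) < m → eBR i = 0)
    (heC_supp : ∀ i : Fin (m + n), (i : ℕ) < m → eC i = 0)
    (hSBPub : Pub * Du + (Pub * Du)ᵀ = vecMulVec eBL eBL - vecMulVec eA eA)
    (hSBPOu : POu * Du + (POu * Du)ᵀ = vecMulVec eC eC - vecMulVec eBR eBR)
    (hDu1 : Du.mulVec (fun _ => 1) = 0)
    (heA1 : eA ⬝ᵥ (fun _ => (1 : ℝ)) = 1)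
    (heBL1 : eBL ⬝ᵥ (fun _ => (1 : ℝ)) = 1)
    (heBR1 : eBR ⬝ᵥ (fun _ => (1 : ℝ)) = 1)
    -- SBP operator on the right mesh
    (Dv Pv : Matrix (Fin Nv) (Fin Nv) ℝ)
    (hPv_offdiag : ∀ i j, i ≠ j → Pv i j = 0)
    (hPv_pos : ∀ i, 0 < Pv i i)
    (eB eD : Fin Nv → ℝ)
    (hSBPv : Pv * Dv + (Pv * Dv)ᵀ = vecMulVec eD eD - vecMulVec eB eB)
    (hDv1 : Dv.mulVec (fun _ => 1) = 0)
    (heB1 : eB ⬝ᵥ (fun _ => (1 : ℝ)) = 1)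
    -- semi-discrete solution
    (u : ℝ → Fin (m + n) → ℝ) (v : ℝ → Fin Nv → ℝ)
    (hu : ∀ t, 0 < t → HasDerivAt u
      ((-α) • Du.mulVec (u t) +
        α • (Pub + POu)⁻¹.mulVec
          ((g t - eA ⬝ᵥ u t) • eA + (eBL ⬝ᵥ u t - eBR ⬝ᵥ u t) • eBR)) t)
    (hv : ∀ t, 0 < t → HasDerivAt v
      ((-α) • Dv.mulVec (v t) +
        α • Pv⁻¹.mulVec ((eBL ⬝ᵥ u t - eB ⬝ᵥ v t) • eB)) t)
    (t : ℝ) (ht : 0 < t) :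
    HasDerivAt (fun s =>
        u s ⬝ᵥ (Pub + POu).mulVec (u s)
          + v s ⬝ᵥ Pv.mulVec (v s)
          - u s ⬝ᵥ POu.mulVec (u s))
      (-α * ((eD ⬝ᵥ v t) ^ 2 - (g t) ^ 2)
        - α * (g t - eA ⬝ᵥ u t) ^ 2
        - α * (eBL ⬝ᵥ u t - eB ⬝ᵥ v t) ^ 2) t ∧
    -α * ((eD ⬝ᵥ v t) ^ 2 - (g t) ^ 2)
        - α * (g t - eA ⬝ᵥ u t) ^ 2
        - α * (eBL ⬝ᵥ u t - eB ⬝ᵥ v t) ^ 2 ≤ α * (g t) ^ 2 := by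
  have hPubD : Pub.IsDiag := fun i j hij => hPub_offdiag i j hij
  have hPOuD : POu.IsDiag := fun i j hij => hPOu_offdiag i j hij
  have hPvD : Pv.IsDiag := fun i j hij => hPv_offdiag i j hij
  have hPu0 (i : Fin (m + n)) : (Pub + POu) i i ≠ 0 := by
    rw [Matrix.add_apply]
    rcases lt_or_ge (i : ℕ) m with hi | hi
    · rw [hPOu_zero i hi, add_zero]
      exact (hPub_pos i hi).ne'
    · rw [hPub_zero i hi, zero_add]
      exact (hPOu_pos i hi).ne'
  have hpen (c d : ℝ) : Pub *ᵥ ((Pub + POu)⁻¹ *ᵥ (c • eA + d • eBR)) = c • eA := by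
    funext i
    have hi := congrFun ((hPubD.add hPOuD).mulVec_inv_mulVec hPu0 (c • eA + d • eBR)) i
    rw [(hPubD.add hPOuD).mulVec_apply, Matrix.add_apply] at hi
    rw [hPubD.mulVec_apply]
    rcases lt_or_ge (i : ℕ) m with him | him
    · simpa [hPOu_zero i him, heBR_supp i him] using hi
    · simp [hPub_zero i him, heA_supp i him]
  constructor
  swap
  · nlinarith [mul_nonneg hα.le (sq_nonneg (eD ⬝ᵥ v t)),
      mul_nonneg hα.le (sq_nonneg (g t - eA ⬝ᵥ u t)),
      mul_nonneg hα.le (sq_nonneg (eBL ⬝ᵥ u t - eB ⬝ᵥ v t))]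
  have hE := (hasDerivAt_dotProduct_mulVec_self hPubD.isSymm (hu t ht)).add
    (hasDerivAt_dotProduct_mulVec_self hPvD.isSymm (hv t ht))
  refine (hE.congr_deriv ?_).congr_of_eventuallyEq (.of_forall fun s => ?_)
  · have hsbpu := two_mul_dotProduct_mulVec_of_sbp hSBPub (u t)
    have hsbpv := two_mul_dotProduct_mulVec_of_sbp hSBPv (v t)
    rw [mulVec_add Pub, mulVec_smul Pub, mulVec_smul Pub, hpen]
    simp only [mulVec_add, mulVec_smul,
      hPvD.mulVec_inv_mulVec fun i => (hPv_pos i).ne', dotProduct_add, dotProduct_smul,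
      smul_eq_mul, dotProduct_comm (u t) eA, dotProduct_comm (v t) eB]
    linear_combination -α * hsbpu - α * hsbpv
  · simp only [Pi.add_apply, add_mulVec, dotProduct_add]
    ring
end

section
/- Under the general-flux overset semi-discretization setup with nodal projection vectors, for every t > 0 the total discrete mass M(t) = 𝟙ᵀ P_ū u(t) + 𝟙ᵀ P_v v(t) satisfies d/dt M(t) = f*(g_L(t), u_1(t)) − f*(v_{N_v}(t), g_R(t)) + f*(u_m(t), v_1(t)) − f*(u_m(t), u_{m+1}(t)). Consequently, if the numerical flux is fully upwind, i.e., f*(w_L, w_R) = f(w_L) for all w_L, w_R ∈ ℝ, then d/dt M(t) = f(g_L(t)) − f(v_{N_v}(t)), so the discrete mass changes only through the physical boundary fluxes. -/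
open Matrix

/-- Discrete integration of a derivative by the summation-by-parts property. -/
lemma one_dotProduct_mulVec_of_sbp {ι : Type*} [Fintype ι] [DecidableEq ι] (P D : Matrix ι ι ℝ)
    (a b : ι)
    (hSBP : P * D + (P * D)ᵀ =
      vecMulVec (Pi.single b 1 : ι → ℝ) (Pi.single b 1 : ι → ℝ)
        - vecMulVec (Pi.single a 1 : ι → ℝ) (Pi.single a 1 : ι → ℝ))
    (hD : D.mulVec (fun _ => 1) = 0) (x : ι → ℝ) :
    (fun _ => (1 : ℝ)) ⬝ᵥ P.mulVec (D.mulVec x) = x b - x a := by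
  have h₁ : (fun _ => (1 : ℝ)) ⬝ᵥ (P * D)ᵀ.mulVec x = 0 := by
    rw [dotProduct_mulVec, vecMul_transpose, ← mulVec_mulVec, hD, mulVec_zero, zero_dotProduct]
  have h₂ := congrArg (fun A => (fun _ => (1 : ℝ)) ⬝ᵥ A.mulVec x) hSBP
  simp only [add_mulVec, sub_mulVec, dotProduct_add, dotProduct_sub, h₁, add_zero] at h₂
  rw [mulVec_mulVec, h₂]
  simp [vecMulVec_mulVec]

/-- If `P` is the invertible diagonal matrix `R` masked by `s`, then
`𝟙ᵀ P R⁻¹ w = sᵀ w`. -/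
lemma one_dotProduct_mulVec_inv_mulVec {ι : Type*} [Fintype ι] [DecidableEq ι]
    (P R : Matrix ι ι ℝ) (s : ι → ℝ) (hR : ∀ i j, i ≠ j → R i j = 0) (hR' : ∀ i, R i i ≠ 0)
    (hP : ∀ i j, P i j = s i * R i j) (w : ι → ℝ) :
    (fun _ => (1 : ℝ)) ⬝ᵥ P.mulVec (R⁻¹.mulVec w) = s ⬝ᵥ w := by
  have hdiag : R = diagonal fun i => R i i := by
    ext i j
    by_cases h : i = j
    · subst h; simp
    · simp [h, hR i j h]
  have hdet : IsUnit R.det := by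
    rw [hdiag, det_diagonal, isUnit_iff_ne_zero]
    exact Finset.prod_ne_zero_iff.mpr fun i _ => hR' i
  have hPR : P = diagonal s * R := by
    ext i j
    rw [diagonal_mul, hP]
  rw [hPR, mulVec_mulVec, mul_nonsing_inv_cancel_right _ _ hdet]
  simp [dotProduct, mulVec_diagonal]

/-- Linear functionals of the form `x ↦ 𝟙ᵀ P x` commute with differentiation. -/
lemma HasDerivAt.one_dotProduct_mulVec {ι : Type*} [Fintype ι] (P : Matrix ι ι ℝ)
    {x : ℝ → ι → ℝ} {x' : ι → ℝ} {t : ℝ} (hx : HasDerivAt x x' t) :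
    HasDerivAt (fun s => (fun _ => (1 : ℝ)) ⬝ᵥ P.mulVec (x s))
      ((fun _ => (1 : ℝ)) ⬝ᵥ P.mulVec x') t := by
  simp only [dotProduct, mulVec]
  rw [hasDerivAt_pi] at hx
  exact HasDerivAt.fun_sum fun i _ =>
    (HasDerivAt.fun_sum fun j _ => (hx j).const_mul _).const_mul _

/-- Discrete mass balance for the general-flux overset semi-discretization
with nodal projection vectors: the total discrete mass changes according to the numerical
fluxes at the boundaries and at the sub-cell coupling point; if the numerical flux is fully
upwind, only the physical boundary fluxes remain. -/
theorem discrete_overset_mass_general_flux (m n Nv : ℕ)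
    (hm : 0 < m) (hn : 0 < n) (hNv : 0 < Nv)
    (f : ℝ → ℝ) (fstar : ℝ → ℝ → ℝ) (gL gR : ℝ → ℝ)
    -- left-mesh operators
    (Du Pub POu : Matrix (Fin (m + n)) (Fin (m + n)) ℝ)
    (hPub_offdiag : ∀ i j, i ≠ j → Pub i j = 0)
    (hPub_pos : ∀ i : Fin (m + n), (i : ℕ) < m → 0 < Pub i i)
    (hPub_zero : ∀ i : Fin (m + n), m ≤ (i : ℕ) → Pub i i = 0)
    (hPOu_offdiag : ∀ i j, i ≠ j → POu i j = 0)
    (hPOu_pos : ∀ i : Fin (m + n), m ≤ (i : ℕ) → 0 < POu i i)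
    (hPOu_zero : ∀ i : Fin (m + n), (i : ℕ) < m → POu i i = 0)
    (hSBPub : Pub * Du + (Pub * Du)ᵀ =
      vecMulVec ((Pi.single ⟨m - 1, by omega⟩ 1 : Fin (m + n) → ℝ))
          ((Pi.single ⟨m - 1, by omega⟩ 1 : Fin (m + n) → ℝ))
        - vecMulVec ((Pi.single ⟨0, by omega⟩ 1 : Fin (m + n) → ℝ))
          ((Pi.single ⟨0, by omega⟩ 1 : Fin (m + n) → ℝ)))
    (hDu1 : Du.mulVec (fun _ => 1) = 0)
    -- right-mesh operators
    (Dv Pv : Matrix (Fin Nv) (Fin Nv) ℝ)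
    (hPv_offdiag : ∀ i j, i ≠ j → Pv i j = 0)
    (hPv_pos : ∀ i, 0 < Pv i i)
    (hSBPv : Pv * Dv + (Pv * Dv)ᵀ =
      vecMulVec ((Pi.single ⟨Nv - 1, by omega⟩ 1 : Fin Nv → ℝ))
          ((Pi.single ⟨Nv - 1, by omega⟩ 1 : Fin Nv → ℝ))
        - vecMulVec ((Pi.single ⟨0, by omega⟩ 1 : Fin Nv → ℝ))
          ((Pi.single ⟨0, by omega⟩ 1 : Fin Nv → ℝ)))
    (hDv1 : Dv.mulVec (fun _ => 1) = 0)
    -- semi-discrete solution with arbitrary outflow coupling term `r` at `c`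
    (u : ℝ → Fin (m + n) → ℝ) (v : ℝ → Fin Nv → ℝ) (r : ℝ → ℝ)
    (hu : ∀ t, HasDerivAt u
      (-(Du.mulVec (fun i => f (u t i))) +
        (Pub + POu)⁻¹.mulVec
          ((fstar (gL t) (u t ⟨0, by omega⟩) - f (u t ⟨0, by omega⟩)) •
              (Pi.single ⟨0, by omega⟩ 1 : Fin (m + n) → ℝ)
            - r t • (Pi.single ⟨m + n - 1, by omega⟩ 1 : Fin (m + n) → ℝ)
            + (fstar (u t ⟨m - 1, by omega⟩) (u t ⟨m, by omega⟩) - f (u t ⟨m, by omega⟩)) •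
              (Pi.single ⟨m, by omega⟩ 1 : Fin (m + n) → ℝ)
            - (fstar (u t ⟨m - 1, by omega⟩) (u t ⟨m, by omega⟩) - f (u t ⟨m - 1, by omega⟩)) •
              (Pi.single ⟨m - 1, by omega⟩ 1 : Fin (m + n) → ℝ))) t)
    (hv : ∀ t, HasDerivAt v
      (-(Dv.mulVec (fun j => f (v t j))) +
        Pv⁻¹.mulVec
          ((fstar (u t ⟨m - 1, by omega⟩) (v t ⟨0, by omega⟩) - f (v t ⟨0, by omega⟩)) •
              (Pi.single ⟨0, by omega⟩ 1 : Fin Nv → ℝ)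
            - (fstar (v t ⟨Nv - 1, by omega⟩) (gR t) - f (v t ⟨Nv - 1, by omega⟩)) •
              (Pi.single ⟨Nv - 1, by omega⟩ 1 : Fin Nv → ℝ))) t)
    (t : ℝ) (ht : 0 < t) :
    HasDerivAt (fun s =>
        (fun _ => (1 : ℝ)) ⬝ᵥ Pub.mulVec (u s) + (fun _ => (1 : ℝ)) ⬝ᵥ Pv.mulVec (v s))
      (fstar (gL t) (u t ⟨0, by omega⟩) - fstar (v t ⟨Nv - 1, by omega⟩) (gR t)
        + fstar (u t ⟨m - 1, by omega⟩) (v t ⟨0, by omega⟩)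
        - fstar (u t ⟨m - 1, by omega⟩) (u t ⟨m, by omega⟩)) t ∧
    ((∀ wL wR, fstar wL wR = f wL) →
      HasDerivAt (fun s =>
          (fun _ => (1 : ℝ)) ⬝ᵥ Pub.mulVec (u s) + (fun _ => (1 : ℝ)) ⬝ᵥ Pv.mulVec (v s))
        (f (gL t) - f (v t ⟨Nv - 1, by omega⟩)) t) := by
  have hmass : HasDerivAt (fun s =>
        (fun _ => (1 : ℝ)) ⬝ᵥ Pub.mulVec (u s) + (fun _ => (1 : ℝ)) ⬝ᵥ Pv.mulVec (v s))
      (fstar (gL t) (u t ⟨0, by omega⟩) - fstar (v t ⟨Nv - 1, by omega⟩) (gR t)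
        + fstar (u t ⟨m - 1, by omega⟩) (v t ⟨0, by omega⟩)
        - fstar (u t ⟨m - 1, by omega⟩) (u t ⟨m, by omega⟩)) t := by
    have hPu : ∀ w, (fun _ => (1 : ℝ)) ⬝ᵥ Pub.mulVec ((Pub + POu)⁻¹.mulVec w) =
        (fun i : Fin (m + n) => if (i : ℕ) < m then (1 : ℝ) else 0) ⬝ᵥ w := by
      refine one_dotProduct_mulVec_inv_mulVec _ _ _ (fun i j h => ?_) (fun i => ?_) (fun i j => ?_)
      · simp [hPub_offdiag i j h, hPOu_offdiag i j h]
      · rcases lt_or_ge (i : ℕ) m with h | h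
        · simpa [hPOu_zero i h] using (hPub_pos i h).ne'
        · simpa [hPub_zero i h] using (hPOu_pos i h).ne'
      · by_cases hij : i = j
        · subst hij
          rcases lt_or_ge (i : ℕ) m with h | h
          · simp [h, hPOu_zero i h]
          · simp [h.not_gt, hPub_zero i h]
        · simp [hPub_offdiag i j hij, hPOu_offdiag i j hij]
    have hPv : ∀ w, (fun _ => (1 : ℝ)) ⬝ᵥ Pv.mulVec (Pv⁻¹.mulVec w) = (fun _ => (1 : ℝ)) ⬝ᵥ w :=
      one_dotProduct_mulVec_inv_mulVec _ _ _ hPv_offdiag (fun i => (hPv_pos i).ne')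
        (fun i j => (one_mul _).symm)
    have hc : ¬ m + n - 1 < m := by omega
    have hb : m - 1 < m := by omega
    refine (((hu t).one_dotProduct_mulVec Pub).add
      ((hv t).one_dotProduct_mulVec Pv)).congr_deriv ?_
    rw [mulVec_add, mulVec_add, mulVec_neg, mulVec_neg, dotProduct_add, dotProduct_add,
      dotProduct_neg, dotProduct_neg, one_dotProduct_mulVec_of_sbp _ _ _ _ hSBPub hDu1,
      one_dotProduct_mulVec_of_sbp _ _ _ _ hSBPv hDv1, hPu, hPv]
    simp only [dotProduct_add, dotProduct_sub, dotProduct_smul, dotProduct_single_one,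
      smul_eq_mul, hm, hb, hc, lt_irrefl, if_true, if_false]
    ring
  refine ⟨hmass, fun hup => hmass.congr_deriv ?_⟩
  simp only [hup]
  ring
end

section
/- Let a < b < c < d and α > 0, and let u, v : ℝ × [0, ∞) → ℝ be continuously differentiable functions satisfying the linear advection equation ∂_t u + α ∂_x u = 0 on [a, c] × (0, ∞) and ∂_t v + α ∂_x v = 0 on [b, d] × (0, ∞), together with the boundary condition u(a, t) = g(t) and the interface condition v(b, t) = u(b, t) for all t > 0. Then the overset integral I(t) = ∫_a^c u(x, t) dx + ∫_b^d v(x, t) dx − ∫_b^c u(x, t) dx satisfies d/dt I(t) = −α ( v(d, t) − g(t) ) for all t > 0. -/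
open MeasureTheory

/-- On an interval where a `C¹` function satisfies the linear advection equation, its integral
changes at the rate given by the difference of the boundary fluxes. -/
theorem hasDerivAt_integral_of_advection {l r α : ℝ} (hlr : l ≤ r) {f : ℝ → ℝ → ℝ}
    (hf : ContDiffOn ℝ 1 (fun p : ℝ × ℝ => f p.1 p.2) (Set.univ ×ˢ Set.Ioi 0))
    (hpde : ∀ x ∈ Set.Icc l r, ∀ t > (0 : ℝ),
      deriv (fun τ => f x τ) t + α * deriv (fun y => f y t) x = 0)
    {t : ℝ} (ht : 0 < t) :
    HasDerivAt (fun s => ∫ x in l..r, f x s) (-α * (f r t - f l t)) t := by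
  set F : ℝ × ℝ → ℝ := fun p => f p.1 p.2 with hF
  have hO : IsOpen (Set.univ ×ˢ Set.Ioi 0 : Set (ℝ × ℝ)) := isOpen_univ.prod isOpen_Ioi
  have hdiff (x s : ℝ) (hs : 0 < s) : HasFDerivAt F (fderiv ℝ F (x, s)) (x, s) :=
    ((hf.differentiableOn one_ne_zero).differentiableAt
      (hO.mem_nhds (x := (x, s)) ⟨trivial, hs⟩)).hasFDerivAt
  have hdt (x s : ℝ) (hs : 0 < s) :
      HasDerivAt (fun τ => f x τ) (fderiv ℝ F (x, s) (0, 1)) s :=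
    (hdiff x s hs).comp_hasDerivAt s ((hasDerivAt_const s x).prodMk (hasDerivAt_id s))
  have hdx (x s : ℝ) (hs : 0 < s) :
      HasDerivAt (fun y => f y s) (fderiv ℝ F (x, s) (1, 0)) x :=
    HasFDerivAt.comp_hasDerivAt (f := fun y : ℝ => (y, s)) x (hdiff x s hs)
      ((hasDerivAt_id x).prodMk (hasDerivAt_const x s))
  have hcont : ContinuousOn (fderiv ℝ F) (Set.univ ×ˢ Set.Ioi 0) :=
    hf.continuousOn_fderiv_of_isOpen hO le_rfl
  have hslice {s : ℝ} (hs : 0 < s) (w : ℝ × ℝ) : Continuous fun x => fderiv ℝ F (x, s) w :=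
    (hcont.comp_continuous (f := fun x : ℝ => (x, s)) (by fun_prop)
      fun x => ⟨trivial, hs⟩).clm_apply continuous_const
  have hfc {s : ℝ} (hs : 0 < s) : Continuous fun x => f x s :=
    continuous_iff_continuousAt.2 fun x => (hdx x s hs).continuousAt
  obtain ⟨C, hC⟩ := (isCompact_Icc.prod isCompact_Icc :
      IsCompact (Set.Icc l r ×ˢ Set.Icc (t / 2) (2 * t))).exists_bound_of_continuousOn
    (f := fun p => fderiv ℝ F p (0, 1))
    ((hcont.mono fun p hp => ⟨trivial, (half_pos ht).trans_le hp.2.1⟩).clm_apply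
      continuousOn_const)
  have hpos : ∀ᶠ s in nhds t, 0 < s := lt_mem_nhds ht
  have key := (intervalIntegral.hasDerivAt_integral_of_dominated_loc_of_deriv_le
    (μ := volume) (a := l) (b := r) (F := fun s x => f x s)
    (F' := fun s x => fderiv ℝ F (x, s) (0, 1)) (bound := fun _ => C)
    (Icc_mem_nhds (by linarith : t / 2 < t) (by linarith : t < 2 * t))
    (hpos.mono fun s hs => (hfc hs).aestronglyMeasurable)
    ((hfc ht).intervalIntegrable l r)
    (hslice ht _).aestronglyMeasurable
    (.of_forall fun x hx s hs => hC (x, s)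
      ⟨Set.Ioc_subset_Icc_self (by rwa [Set.uIoc_of_le hlr] at hx), hs⟩)
    intervalIntegrable_const
    (.of_forall fun x _ s hs => hdt x s ((half_pos ht).trans_le hs.1))).2
  have hflux : ∫ x in l..r, fderiv ℝ F (x, t) (0, 1) = -α * (f r t - f l t) := by
    rw [← intervalIntegral.integral_eq_sub_of_hasDerivAt (fun x _ => hdx x t ht)
      ((hslice ht _).intervalIntegrable l r), ← intervalIntegral.integral_const_mul]
    refine intervalIntegral.integral_congr fun x hx => ?_
    have h := hpde x (by rwa [Set.uIcc_of_le hlr] at hx) t ht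
    rw [(hdt x t ht).deriv, (hdx x t ht).deriv] at h
    linarith
  rwa [hflux] at key

/-- Conservation for the continuous overset domain problem for the linear
advection equation: the overset integral
`I(t) = ∫_a^c u + ∫_b^d v − ∫_b^c u` satisfies `d/dt I(t) = −α (v(d,t) − g(t))`. -/
theorem overset_integral_conservation (a b c d α : ℝ)
    (hab : a < b) (hbc : b < c) (hcd : c < d) (hα : 0 < α)
    (g : ℝ → ℝ) (u v : ℝ → ℝ → ℝ)
    (hu_reg : ContDiffOn ℝ 1 (fun p : ℝ × ℝ => u p.1 p.2) (Set.univ ×ˢ Set.Ici 0))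
    (hv_reg : ContDiffOn ℝ 1 (fun p : ℝ × ℝ => v p.1 p.2) (Set.univ ×ˢ Set.Ici 0))
    (hu_pde : ∀ x ∈ Set.Icc a c, ∀ t > (0 : ℝ),
      deriv (fun τ => u x τ) t + α * deriv (fun y => u y t) x = 0)
    (hv_pde : ∀ x ∈ Set.Icc b d, ∀ t > (0 : ℝ),
      deriv (fun τ => v x τ) t + α * deriv (fun y => v y t) x = 0)
    (hbcond : ∀ t > (0 : ℝ), u a t = g t)
    (hicond : ∀ t > (0 : ℝ), v b t = u b t)
    (t : ℝ) (ht : 0 < t) :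
    HasDerivAt (fun s => (∫ x in a..c, u x s) + (∫ x in b..d, v x s) - ∫ x in b..c, u x s)
      (-α * (v d t - g t)) t := by
  have hsub : (Set.univ ×ˢ Set.Ioi 0 : Set (ℝ × ℝ)) ⊆ Set.univ ×ˢ Set.Ici 0 :=
    Set.prod_mono_right Set.Ioi_subset_Ici_self
  have hac := hasDerivAt_integral_of_advection (hab.trans hbc).le (hu_reg.mono hsub) hu_pde ht
  have hbd := hasDerivAt_integral_of_advection (hbc.trans hcd).le (hv_reg.mono hsub) hv_pde ht
  have hbc' := hasDerivAt_integral_of_advection hbc.le (hu_reg.mono hsub)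
    (fun x hx => hu_pde x ⟨hab.le.trans hx.1, hx.2⟩) ht
  refine ((hac.add hbd).sub hbc').congr_deriv ?_
  rw [← hbcond t ht, hicond t ht]
  ring
end

section
/- Let a < b < c < d and α > 0, and let u, v : ℝ × [0, ∞) → ℝ be continuously differentiable functions satisfying the linear advection equation ∂_t u + α ∂_x u = 0 on [a, c] × (0, ∞) and ∂_t v + α ∂_x v = 0 on [b, d] × (0, ∞), together with the boundary condition u(a, t) = g(t) and the interface condition v(b, t) = u(b, t) for all t > 0. Then the overset energy E(t) = ∫_a^c u(x, t)² dx + ∫_b^d v(x, t)² dx − ∫_b^c u(x, t)² dx satisfies d/dt E(t) = −α ( v(d, t)² − g(t)² ) for all t > 0; in particular d/dt E(t) ≤ α g(t)². -/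
open MeasureTheory

/-- Differentiation under the integral sign for a `C¹` function on an open time half-line. -/
theorem hasDerivAt_integral_of_contDiffOn_Ioi {F : ℝ × ℝ → ℝ}
    (hF : ContDiffOn ℝ 1 F (Set.univ ×ˢ Set.Ioi 0)) (p q : ℝ) {t : ℝ} (ht : 0 < t) :
    HasDerivAt (fun s => ∫ x in p..q, F (x, s)) (∫ x in p..q, fderiv ℝ F (x, t) (0, 1)) t := by
  have hU : IsOpen (Set.univ ×ˢ Set.Ioi 0 : Set (ℝ × ℝ)) := isOpen_univ.prod isOpen_Ioi
  have hdF : ContinuousOn (fun z => fderiv ℝ F z (0, 1)) (Set.univ ×ˢ Set.Ioi 0) :=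
    (hF.continuousOn_fderiv_of_isOpen hU le_rfl).clm_apply continuousOn_const
  have slice {G : ℝ × ℝ → ℝ} (hG : ContinuousOn G (Set.univ ×ˢ Set.Ioi 0)) {s : ℝ}
      (hs : 0 < s) : Continuous fun x => G (x, s) :=
    hG.comp_continuous (by fun_prop) fun x => ⟨trivial, hs⟩
  obtain ⟨C, hC⟩ := (isCompact_uIcc.prod isCompact_Icc :
      IsCompact (Set.uIcc p q ×ˢ Set.Icc (t / 2) (2 * t))).exists_bound_of_continuousOn
    (hdF.mono fun z hz => ⟨trivial, (half_pos ht).trans_le hz.2.1⟩)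
  refine (intervalIntegral.hasDerivAt_integral_of_dominated_loc_of_deriv_le
    (F := fun s x => F (x, s)) (F' := fun s x => fderiv ℝ F (x, s) (0, 1))
    (bound := fun _ => C)
    (Icc_mem_nhds (by linarith : t / 2 < t) (by linarith : t < 2 * t)) ?_
    ((slice hF.continuousOn ht).intervalIntegrable _ _)
    (slice hdF ht).aestronglyMeasurable ?_ intervalIntegrable_const ?_).2
  · filter_upwards [Ioi_mem_nhds ht] with s hs
    exact (slice hF.continuousOn hs).aestronglyMeasurable
  · exact .of_forall fun x hx s hs => hC (x, s) ⟨Set.uIoc_subset_uIcc hx, hs⟩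
  · refine .of_forall fun x _ s hs => ?_
    have hs0 : 0 < s := (half_pos ht).trans_le hs.1
    have hd := (hF.differentiableOn one_ne_zero).differentiableAt
      (hU.mem_nhds (show (x, s) ∈ _ from ⟨trivial, hs0⟩))
    exact hd.hasFDerivAt.comp_hasDerivAt s ((hasDerivAt_const s x).prodMk (hasDerivAt_id s))

/-- The energy of a solution of the advection equation on `[p, q]` changes only by the fluxes
through the end points. -/
theorem hasDerivAt_integral_sq_of_advection {α p q : ℝ} (hpq : p ≤ q) {w : ℝ → ℝ → ℝ}
    (hw : ContDiffOn ℝ 1 (fun z : ℝ × ℝ => w z.1 z.2) (Set.univ ×ˢ Set.Ioi 0))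
    {t : ℝ} (ht : 0 < t)
    (hpde : ∀ x ∈ Set.Icc p q, deriv (fun τ => w x τ) t + α * deriv (fun y => w y t) x = 0) :
    HasDerivAt (fun s => ∫ x in p..q, (w x s) ^ 2) (-α * ((w q t) ^ 2 - (w p t) ^ 2)) t := by
  set W : ℝ × ℝ → ℝ := fun z => w z.1 z.2 with hW
  have hU : IsOpen (Set.univ ×ˢ Set.Ioi 0 : Set (ℝ × ℝ)) := isOpen_univ.prod isOpen_Ioi
  have hd (x : ℝ) : HasFDerivAt W (fderiv ℝ W (x, t)) (x, t) :=
    ((hw.differentiableOn one_ne_zero).differentiableAt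
      (hU.mem_nhds (show (x, t) ∈ _ from ⟨trivial, ht⟩))).hasFDerivAt
  have htime (x : ℝ) : HasDerivAt (fun τ => w x τ) (fderiv ℝ W (x, t) (0, 1)) t :=
    (hd x).comp_hasDerivAt t ((hasDerivAt_const t x).prodMk (hasDerivAt_id t))
  have hspace (x : ℝ) : HasDerivAt (fun y => w y t) (fderiv ℝ W (x, t) (1, 0)) x :=
    (hd x).comp_hasDerivAt (f := fun y => (y, t)) x
      ((hasDerivAt_id x).prodMk (hasDerivAt_const x t))
  have hcont : Continuous fun x => fderiv ℝ W (x, t) (1, 0) :=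
    ((hw.continuousOn_fderiv_of_isOpen hU le_rfl).clm_apply continuousOn_const).comp_continuous
      (by fun_prop) fun x => ⟨trivial, ht⟩
  have hwcont : Continuous fun x => w x t :=
    continuous_iff_continuousAt.2 fun x => (hspace x).continuousAt
  have hflux : ∫ x in p..q, 2 * w x t * fderiv ℝ W (x, t) (1, 0) = w q t ^ 2 - w p t ^ 2 :=
    intervalIntegral.integral_eq_sub_of_hasDerivAt
      (fun x _ => by simpa using (hspace x).pow 2)
      (Continuous.intervalIntegrable (by fun_prop) _ _)
  convert hasDerivAt_integral_of_contDiffOn_Ioi (hw.pow 2) p q ht using 1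
  rw [← hflux, ← intervalIntegral.integral_const_mul]
  refine intervalIntegral.integral_congr fun x hx => ?_
  rw [Set.uIcc_of_le hpq] at hx
  have hx' := hpde x hx
  rw [(htime x).deriv, (hspace x).deriv] at hx'
  have hsq : fderiv ℝ (fun z => W z ^ 2) (x, t) (0, 1) =
      2 * w x t * fderiv ℝ W (x, t) (0, 1) := by
    rw [((hd x).pow 2).fderiv]
    simp [hW]
  simp only [hW] at hsq hx' ⊢
  rw [hsq]
  linear_combination (-2 * w x t) * hx'

/-- Energy stability for the continuous overset domain problem for the
linear advection equation: the overset energy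
`E(t) = ∫_a^c u² + ∫_b^d v² − ∫_b^c u²` satisfies `d/dt E(t) = −α (v(d,t)² − g(t)²)`;
in particular `d/dt E(t) ≤ α g(t)²`. -/
theorem overset_energy_stability (a b c d α : ℝ)
    (hab : a < b) (hbc : b < c) (hcd : c < d) (hα : 0 < α)
    (g : ℝ → ℝ) (u v : ℝ → ℝ → ℝ)
    (hu_reg : ContDiffOn ℝ 1 (fun p : ℝ × ℝ => u p.1 p.2) (Set.univ ×ˢ Set.Ici 0))
    (hv_reg : ContDiffOn ℝ 1 (fun p : ℝ × ℝ => v p.1 p.2) (Set.univ ×ˢ Set.Ici 0))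
    (hu_pde : ∀ x ∈ Set.Icc a c, ∀ t > (0 : ℝ),
      deriv (fun τ => u x τ) t + α * deriv (fun y => u y t) x = 0)
    (hv_pde : ∀ x ∈ Set.Icc b d, ∀ t > (0 : ℝ),
      deriv (fun τ => v x τ) t + α * deriv (fun y => v y t) x = 0)
    (hbcond : ∀ t > (0 : ℝ), u a t = g t)
    (hicond : ∀ t > (0 : ℝ), v b t = u b t)
    (t : ℝ) (ht : 0 < t) :
    HasDerivAt (fun s =>
        (∫ x in a..c, (u x s) ^ 2) + (∫ x in b..d, (v x s) ^ 2) - ∫ x in b..c, (u x s) ^ 2)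
      (-α * ((v d t) ^ 2 - (g t) ^ 2)) t ∧
    -α * ((v d t) ^ 2 - (g t) ^ 2) ≤ α * (g t) ^ 2 := by
  have hsub : (Set.univ ×ˢ Set.Ioi 0 : Set (ℝ × ℝ)) ⊆ Set.univ ×ˢ Set.Ici 0 :=
    Set.prod_mono_right Set.Ioi_subset_Ici_self
  have hu := hu_reg.mono hsub
  have hv := hv_reg.mono hsub
  refine ⟨?_, by nlinarith [mul_nonneg hα.le (sq_nonneg (v d t))]⟩
  have huac := hasDerivAt_integral_sq_of_advection (hab.trans hbc).le hu ht
    fun x hx => hu_pde x hx t ht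
  have hvbd := hasDerivAt_integral_sq_of_advection (hbc.trans hcd).le hv ht
    fun x hx => hv_pde x hx t ht
  have hubc := hasDerivAt_integral_sq_of_advection hbc.le hu ht
    fun x hx => hu_pde x ⟨hab.le.trans hx.1, hx.2⟩ t ht
  refine ((huac.add hvbd).sub hubc).congr_deriv ?_
  rw [← hbcond t ht, hicond t ht]
  ring
end

section
/- Let Ω_ref = [−1, 1], ω_M = 0, Ω_L = [−1, 0], Ω_R = [0, 1], and nodes x = (−1, −1/3, 1/3, 1) (so N_L = N_R = 2, and ω_M is not a node). Define the 4×4 matrices P_L = diag(1/4, 3/4, 0, 0), P_R = diag(0, 0, 3/4, 1/4), P = P_L + P_R = diag(1/4, 3/4, 3/4, 1/4), B_L = blockdiag((3/4)·[[−1, −1], [−1, 3]], 0₂), B_R = blockdiag(0₂, (3/4)·[[−3, 1], [1, 1]]), B = B_L + B_R, S_L = blockdiag((3/4)·[[0, 1], [−1, 0]], 0₂), S_R = blockdiag(0₂, (3/4)·[[0, 1], [−1, 0]]), Q_{L/R} = S_{L/R} + B_{L/R}/2, and D = P^{-1}(S_L + S_R + B/2) = (3/2)·blockdiag([[−1, 1],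 [−1, 1]], [[−1, 1], [−1, 1]]). Then D together with P_L, P_R, Q_L, Q_R, B_L, B_R is a 𝒫_1-exact sub-cell SBP operator for (Ω_ref, Ω_L, Ω_R) on the nodes x, where 𝒫_1 = span{1, x}; in particular the boundary exactness conditions 𝐟ᵀ B_L 𝐠 = f(0)g(0) − f(−1)g(−1) and 𝐟ᵀ B_R 𝐠 = f(1)g(1) − f(0)g(0) hold for all f, g ∈ 𝒫_1. -/
open Matrix

namespace GaussRadauExample

/-- Basis of `𝒫₁ = span{1, x}`. -/
noncomputable def fs : Fin 2 → ℝ → ℝ := ![fun _ => 1, fun t => t]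

/-- Nodes `x = (−1, −1/3, 1/3, 1)` on `Ω_L = [−1, 0]` and `Ω_R = [0, 1]`
(the midpoint `ω_M = 0` is not a node). -/
noncomputable def x : Fin 2 ⊕ Fin 2 → ℝ := Sum.elim ![-1, -1/3] ![1/3, 1]

noncomputable def PL : Matrix (Fin 2 ⊕ Fin 2) (Fin 2 ⊕ Fin 2) ℝ :=
  fromBlocks !![1/4, 0; 0, 3/4] 0 0 0

noncomputable def PR : Matrix (Fin 2 ⊕ Fin 2) (Fin 2 ⊕ Fin 2) ℝ :=
  fromBlocks 0 0 0 !![3/4, 0; 0, 1/4]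

noncomputable def BL : Matrix (Fin 2 ⊕ Fin 2) (Fin 2 ⊕ Fin 2) ℝ :=
  fromBlocks ((3 / 4 : ℝ) • !![-1, -1; -1, 3]) 0 0 0

noncomputable def BR : Matrix (Fin 2 ⊕ Fin 2) (Fin 2 ⊕ Fin 2) ℝ :=
  fromBlocks 0 0 0 ((3 / 4 : ℝ) • !![-3, 1; 1, 1])

noncomputable def SL : Matrix (Fin 2 ⊕ Fin 2) (Fin 2 ⊕ Fin 2) ℝ :=
  fromBlocks ((3 / 4 : ℝ) • !![0, 1; -1, 0]) 0 0 0

noncomputable def SR : Matrix (Fin 2 ⊕ Fin 2) (Fin 2 ⊕ Fin 2) ℝ :=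
  fromBlocks 0 0 0 ((3 / 4 : ℝ) • !![0, 1; -1, 0])

noncomputable def QL : Matrix (Fin 2 ⊕ Fin 2) (Fin 2 ⊕ Fin 2) ℝ := SL + (1 / 2 : ℝ) • BL

noncomputable def QR : Matrix (Fin 2 ⊕ Fin 2) (Fin 2 ⊕ Fin 2) ℝ := SR + (1 / 2 : ℝ) • BR

noncomputable def D : Matrix (Fin 2 ⊕ Fin 2) (Fin 2 ⊕ Fin 2) ℝ :=
  (3 / 2 : ℝ) • fromBlocks !![-1, 1; -1, 1] 0 0 !![-1, 1; -1, 1]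

theorem PL_mul_D : PL * D = QL := by
  simp only [PL, D, QL, SL, BL, mul_smul_comm, fromBlocks_multiply, fromBlocks_smul,
    fromBlocks_add]
  congr 1 <;> ext i j <;> fin_cases i <;> fin_cases j <;> norm_num [Matrix.mul_apply]

theorem PR_mul_D : PR * D = QR := by
  simp only [PR, D, QR, SR, BR, mul_smul_comm, fromBlocks_multiply, fromBlocks_smul,
    fromBlocks_add]
  congr 1 <;> ext i j <;> fin_cases i <;> fin_cases j <;> norm_num [Matrix.mul_apply]

theorem PL_add_PR_eq_diagonal :
    PL + PR = diagonal (Sum.elim ![1 / 4, 3 / 4] ![3 / 4, 1 / 4]) := by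
  ext (i | i) (j | j) <;> fin_cases i <;> fin_cases j <;> simp [PL, PR]

theorem isUnit_det_PL_add_PR : IsUnit (PL + PR).det := by
  rw [PL_add_PR_eq_diagonal, det_diagonal]
  norm_num [Fin.prod_univ_two]

theorem D_eq_inv_mul : D = (PL + PR)⁻¹ * (QL + QR) := by
  rw [← PL_mul_D, ← PR_mul_D, ← Matrix.add_mul,
    Matrix.nonsing_inv_mul_cancel_left _ _ isUnit_det_PL_add_PR]

theorem InSpan.exists_affine {f : ℝ → ℝ} (hf : InSpan fs f) :
    ∃ a b : ℝ, f = fun t => a + b * t := by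
  obtain ⟨c, rfl⟩ := hf
  exact ⟨c 0, c 1, by simp [fs]⟩

theorem deriv_affine (a b t : ℝ) : deriv (fun t => a + b * t) t = b := by
  simp

/-- The coupled Gauss–Radau operators form a `𝒫₁`-exact sub-cell SBP
operator for `(Ω_ref, Ω_L, Ω_R) = ([−1,1], [−1,0], [0,1])` on the nodes
`(−1, −1/3, 1/3, 1)`; moreover `D = P⁻¹ (S_L + S_R + B/2)`. -/
theorem gauss_radau_subcell_sbp :
    D = (PL + PR)⁻¹ * (SL + SR + (1 / 2 : ℝ) • (BL + BR)) ∧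
    IsSubcellSBP fs x (-1) 0 1 D PL PR QL QR BL BR := by
  refine ⟨?_, D_eq_inv_mul, ?_, ?_, ?_, ?_, ?_, ?_, ?_, PL_mul_D, PR_mul_D, ?_, ?_, ?_, ?_⟩
  · rw [D_eq_inv_mul, QL, QR, smul_add, add_add_add_comm]
  · intro f hf
    obtain ⟨a, b, rfl⟩ := InSpan.exists_affine hf
    ext (i | i) <;> fin_cases i <;>
      simp [D, x, deriv_affine, mulVec, dotProduct, Fin.sum_univ_two] <;> ring
  · rintro (i | i) (j | j) h <;> fin_cases i <;> fin_cases j <;> simp_all [PL]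
  · intro i; fin_cases i <;> norm_num [PL]
  · intro i; simp [PL]
  · rintro (i | i) (j | j) h <;> fin_cases i <;> fin_cases j <;> simp_all [PR]
  · intro i; fin_cases i <;> norm_num [PR]
  · intro i; simp [PR]
  · ext (i | i) (j | j) <;> fin_cases i <;> fin_cases j <;> norm_num [QL, SL, BL]
  · ext (i | i) (j | j) <;> fin_cases i <;> fin_cases j <;> norm_num [QR, SR, BR]
  · intro f g hf hg
    obtain ⟨a, b, rfl⟩ := InSpan.exists_affine hf
    obtain ⟨c, d, rfl⟩ := InSpan.exists_affine hg
    simp [BL, x, mulVec, dotProduct, Fin.sum_univ_two]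
    ring
  · intro f g hf hg
    obtain ⟨a, b, rfl⟩ := InSpan.exists_affine hf
    obtain ⟨c, d, rfl⟩ := InSpan.exists_affine hg
    simp [BR, x, mulVec, dotProduct, Fin.sum_univ_two]
    ring

end GaussRadauExample
end

section
/- Let ω_L < ω_M < ω_R and let Ω_L = [ω_L, ω_M] and Ω_R = [ω_M, ω_R] carry nodes x_L ∈ ℝ^{N_L} and x_R ∈ ℝ^{N_R} and 𝔉-exact SBP operators: D̃_L, P̃_L, B̃_L ∈ ℝ^{N_L×N_L} with D̃_L f(x_L) = f'(x_L) for all f ∈ 𝔉, P̃_L diagonal positive definite, P̃_L D̃_L + (P̃_L D̃_L)ᵀ = B̃_L, and f(x_L)ᵀ B̃_L g(x_L) = f(ω_M)g(ω_M) − f(ω_L)g(ω_L) for all f, g ∈ 𝔉; and analogously D̃_R, P̃_R, B̃_R ∈ ℝ^{N_R×N_R} on Ω_R with f(x_R)ᵀ B̃_R g(x_R) = f(ω_R)g(ω_R) − f(ω_M)g(ω_M). Then the assembled matrices D = blockdiag(D̃_L, D̃_R), P_L = blockdiag(P̃_L, 0), P_R = blockdiag(0, P̃_R), B_L = blockdiag(B̃_L,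 0), B_R = blockdiag(0, B̃_R), Q_L = P_L D, Q_R = P_R D form an 𝔉-exact sub-cell SBP operator for (Ω_ref, Ω_L, Ω_R) on the concatenated nodes x = [x_L; x_R], i.e., conditions (i)–(v) of the sub-cell SBP definition hold. -/
open Matrix

theorem isUnit_det_of_diagonal_pos {n : ℕ} {P : Matrix (Fin n) (Fin n) ℝ}
    (hoff : ∀ i j, i ≠ j → P i j = 0) (hpos : ∀ i, 0 < P i i) : IsUnit P.det := by
  have hP : P = diagonal fun i => P i i := by
    ext i j
    by_cases h : i = j
    · simp [h]
    · rw [diagonal_apply_ne _ h, hoff i j h]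
  rw [hP, det_diagonal, isUnit_iff_ne_zero]
  exact (Finset.prod_pos fun i _ => hpos i).ne'

theorem comp_sumElim {α β : Type*} (f : ℝ → ℝ) (a : α → ℝ) (b : β → ℝ) :
    (fun i => f (Sum.elim a b i)) = Sum.elim (fun i => f (a i)) fun i => f (b i) := by
  ext (i | i) <;> rfl

/-- Assembling `𝔉`-exact SBP operators on the two sub-cells
`Ω_L = [ωL, ωM]` and `Ω_R = [ωM, ωR]` into block-diagonal matrices yields an `𝔉`-exact
sub-cell SBP operator for `(Ω_ref, Ω_L, Ω_R)` on the concatenated nodes. -/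
theorem assembled_subcell_sbp {NL NR K : ℕ} (fs : Fin K → ℝ → ℝ)
    (hdiff : ∀ k, Differentiable ℝ (fs k))
    (ωL ωM ωR : ℝ) (hLM : ωL < ωM) (hMR : ωM < ωR)
    (xL : Fin NL → ℝ) (xR : Fin NR → ℝ)
    (DL PtL BtL : Matrix (Fin NL) (Fin NL) ℝ)
    (DR PtR BtR : Matrix (Fin NR) (Fin NR) ℝ)
    (hL : IsSBP fs xL ωL ωM DL PtL BtL)
    (hR : IsSBP fs xR ωM ωR DR PtR BtR) :
    IsSubcellSBP fs (Sum.elim xL xR) ωL ωM ωR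
      (fromBlocks DL 0 0 DR)
      (fromBlocks PtL 0 0 0) (fromBlocks 0 0 0 PtR)
      (fromBlocks PtL 0 0 0 * fromBlocks DL 0 0 DR)
      (fromBlocks 0 0 0 PtR * fromBlocks DL 0 0 DR)
      (fromBlocks BtL 0 0 0) (fromBlocks 0 0 0 BtR) := by
  obtain ⟨hDL, hoffL, hposL, hsbpL, hbdL⟩ := hL
  obtain ⟨hDR, hoffR, hposR, hsbpR, hbdR⟩ := hR
  refine ⟨?_, ?_, ?_, hposL, fun _ => rfl, ?_, hposR, fun _ => rfl, rfl, rfl, ?_, ?_, ?_, ?_⟩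
  · have hdet : IsUnit
        (fromBlocks PtL 0 0 0 + fromBlocks 0 0 0 PtR :
          Matrix (Fin NL ⊕ Fin NR) (Fin NL ⊕ Fin NR) ℝ).det := by
      simpa [fromBlocks_add, det_fromBlocks_zero₂₁] using
        And.intro (isUnit_det_of_diagonal_pos hoffL hposL).ne_zero
          (isUnit_det_of_diagonal_pos hoffR hposR).ne_zero
    rw [← Matrix.add_mul, nonsing_inv_mul_cancel_left _ _ hdet]
  · intro f hf
    rw [comp_sumElim f, comp_sumElim (deriv f), fromBlocks_mulVec]
    simp [Function.comp_def, hDL f hf, hDR f hf]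
  · rintro (i | i) (j | j) h
    · exact hoffL i j fun e => h (congrArg _ e)
    all_goals rfl
  · rintro (i | i) (j | j) h
    on_goal 4 => exact hoffR i j fun e => h (congrArg _ e)
    all_goals rfl
  · simp [fromBlocks_multiply, fromBlocks_transpose, fromBlocks_add, ← hsbpL]
  · simp [fromBlocks_multiply, fromBlocks_transpose, fromBlocks_add, ← hsbpR]
  · intro f g hf hg
    rw [comp_sumElim f, comp_sumElim g, fromBlocks_mulVec, sumElim_dotProduct_sumElim]
    simpa [Function.comp_def] using hbdL f g hf hg
  · intro f g hf hg
    rw [comp_sumElim f, comp_sumElim g, fromBlocks_mulVec, sumElim_dotProduct_sumElim]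
    simpa [Function.comp_def] using hbdR f g hf hg
end
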